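/- arXiv:2109.08816 — 3 statements merged into one kernel-verified Lean document; each statement's English description precedes it below -/
import Mathlib

section
/- For all a, n ∈ ℕ, ∫₀^∞ e^{−x}·L_a^{(1)}(x)·L_n^{(−2)}(x) dx = δ_{n,0} − δ_{n,1} + δ_{n−2,a} − δ_{n−1,a}. -/
open MeasureTheory Finset

/-- Generalized Laguerre polynomial
`L_n^{(α)}(x) = ∑_{k=0}^{n} ((−1)^k/k!)·((α+k+1)⋯(α+n)/(n−k)!)·x^k`,
defined for any real `α`. -/
noncomputable def genLaguerre (n : ℕ) (α : ℝ) (x : ℝ) : ℝ :=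
  ∑ k ∈ Finset.range (n + 1),
    ((-1 : ℝ) ^ k / k.factorial) *
      ((∏ j ∈ Finset.Icc (k + 1) n, (α + j)) / (n - k).factorial) * x ^ k

theorem alternating_sum_choose_mul_choose_add (n m y : ℕ) :
    ∑ i ∈ range (n + 1), (-1 : ℤ) ^ i * n.choose i * (y + i).choose m
      = (-1) ^ n * (if n ≤ m then (y.choose (m - n) : ℤ) else 0) := by
  have hdiff : (fwdDiff 1)^[n] (fun x ↦ x.choose m : ℕ → ℤ) y
      = if n ≤ m then (y.choose (m - n) : ℤ) else 0 := by
    split_ifs with h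
    · obtain ⟨j, rfl⟩ := Nat.exists_eq_add_of_le h
      rw [fwdDiff_iter_choose, Nat.add_sub_cancel_left]
    · obtain ⟨k, rfl⟩ := Nat.exists_eq_add_of_lt (not_le.1 h)
      have hconst := fwdDiff_iter_choose 0 m
      rw [add_zero] at hconst
      rw [show m + k + 1 = (k + 1) + m by ring, Function.iterate_add_apply, hconst]
      simp only [Nat.choose_zero_right, Nat.cast_one, Function.iterate_succ_apply, fwdDiff_const]
      simp only [fwdDiff_iter_eq_sum_shift, smul_zero, sum_const_zero]
  rw [← hdiff, fwdDiff_iter_eq_sum_shift, mul_sum]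
  refine sum_congr rfl fun i hi ↦ ?_
  obtain ⟨d, rfl⟩ := Nat.exists_eq_add_of_le (Nat.lt_succ_iff.1 (mem_range.1 hi))
  have hsq : (-1 : ℤ) ^ d * (-1) ^ d = 1 := by rw [← mul_pow]; simp
  simp only [smul_eq_mul, mul_one, Nat.add_sub_cancel_left, pow_add]
  linear_combination
    (-(-1 : ℤ) ^ i * (i + d).choose i * (y + i).choose m) * hsq

theorem prod_Icc_const_add_mul_factorial {c k n : ℕ} (hk : k ≤ n) :
    (∏ j ∈ Icc (k + 1) n, ((c : ℝ) + j)) * (c + k).factorial = (c + n).factorial := by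
  induction n, hk using Nat.le_induction with
  | base => simp
  | succ n hn ih =>
    rw [prod_Icc_succ_top (by omega), mul_right_comm, ih, ← add_assoc, Nat.factorial_succ]
    push_cast
    ring

theorem prod_Icc_neg_two_add_mul_factorial {k n : ℕ} (hk : k ≤ n) :
    (∏ j ∈ Icc (k + 2 + 1) (n + 2), ((-2 : ℝ) + j)) * k.factorial = n.factorial := by
  induction n, hk using Nat.le_induction with
  | base => simp
  | succ n hn ih =>
    rw [show n + 1 + 2 = n + 2 + 1 by ring, prod_Icc_succ_top (by omega), mul_right_comm, ih,
      Nat.factorial_succ]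
    push_cast
    ring

theorem genLaguerre_one (n : ℕ) (x : ℝ) :
    genLaguerre n 1 x = ∑ k ∈ range (n + 1),
      ((-1 : ℝ) ^ k / k.factorial * (n + 1).choose (k + 1)) * x ^ k := by
  refine sum_congr rfl fun k hk ↦ ?_
  have hk : k ≤ n := Nat.lt_succ_iff.1 (mem_range.1 hk)
  have hprod := prod_Icc_const_add_mul_factorial (c := 1) hk
  rw [Nat.cast_one, add_comm 1 k, add_comm 1 n] at hprod
  rw [Nat.cast_choose ℝ (Nat.succ_le_succ hk), ← hprod, Nat.succ_sub_succ]
  field_simp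

theorem genLaguerre_neg_two_add_two (n : ℕ) (x : ℝ) :
    genLaguerre (n + 2) (-2) x = ∑ k ∈ range (n + 1),
      ((-1 : ℝ) ^ k / (k + 2).factorial * n.choose k) * x ^ (k + 2) := by
  have hzero : ∏ j ∈ Icc 1 (n + 2), ((-2 : ℝ) + j) = 0 :=
    prod_eq_zero (i := 2) (by simp) (by norm_num)
  have hone : ∏ j ∈ Icc 2 (n + 2), ((-2 : ℝ) + j) = 0 :=
    prod_eq_zero (i := 2) (by simp) (by norm_num)
  rw [genLaguerre, sum_range_succ', sum_range_succ']
  simp only [zero_add, Nat.reduceAdd, hzero, hone, zero_div, mul_zero, zero_mul, add_zero]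
  refine sum_congr rfl fun k hk ↦ ?_
  have hk : k ≤ n := Nat.lt_succ_iff.1 (mem_range.1 hk)
  have hprod := prod_Icc_neg_two_add_mul_factorial hk
  rw [Nat.cast_choose ℝ hk, ← hprod, show k + 1 + 1 = k + 2 from rfl, Nat.add_sub_add_right,
    pow_add]
  field_simp

theorem integrableOn_exp_neg_mul_pow (k : ℕ) :
    IntegrableOn (fun x : ℝ ↦ Real.exp (-x) * x ^ k) (Set.Ioi 0) := by
  simpa using Real.GammaIntegral_convergent (s := k + 1) (by positivity)

theorem integral_exp_neg_mul_pow (k : ℕ) :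
    ∫ x in Set.Ioi (0 : ℝ), Real.exp (-x) * x ^ k = k.factorial := by
  rw [← Real.Gamma_nat_eq_factorial, Real.Gamma_eq_integral (by positivity)]
  simp

theorem exp_neg_mul_genLaguerre_one_mul_pow (a m : ℕ) (x : ℝ) :
    Real.exp (-x) * genLaguerre a 1 x * x ^ m = ∑ k ∈ range (a + 1),
      ((-1 : ℝ) ^ k / k.factorial * (a + 1).choose (k + 1)) * (Real.exp (-x) * x ^ (m + k)) := by
  rw [genLaguerre_one, mul_sum, sum_mul]
  exact sum_congr rfl fun k _ ↦ by ring

theorem integrableOn_genLaguerre_one_mul_pow (a m : ℕ) :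
    IntegrableOn (fun x ↦ Real.exp (-x) * genLaguerre a 1 x * x ^ m) (Set.Ioi 0) := by
  simp only [exp_neg_mul_genLaguerre_one_mul_pow]
  exact integrable_finsetSum _ fun k _ ↦ (integrableOn_exp_neg_mul_pow (m + k)).const_mul _

theorem integral_genLaguerre_one_mul_pow (a m : ℕ) :
    ∫ x in Set.Ioi (0 : ℝ), Real.exp (-x) * genLaguerre a 1 x * x ^ m
      = m.factorial * ((∑ k ∈ range (a + 1),
          (-1 : ℤ) ^ k * (a + 1).choose (k + 1) * (m + k).choose m : ℤ) : ℝ) := by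
  simp only [exp_neg_mul_genLaguerre_one_mul_pow]
  rw [integral_finsetSum _ fun k _ ↦ (integrableOn_exp_neg_mul_pow (m + k)).const_mul _]
  simp only [integral_const_mul, integral_exp_neg_mul_pow]
  push_cast
  rw [mul_sum]
  refine sum_congr rfl fun k _ ↦ ?_
  rw [Nat.cast_add_choose ℝ]
  field_simp

theorem integral_genLaguerre_one (a : ℕ) :
    ∫ x in Set.Ioi (0 : ℝ), Real.exp (-x) * genLaguerre a 1 x = 1 := by
  have h := integral_genLaguerre_one_mul_pow a 0
  have hsum := alternating_sum_choose_mul_choose_add (a + 1) 0 0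
  rw [sum_range_succ'] at hsum
  simp only [pow_succ, Nat.choose_zero_right, mul_neg_one, neg_mul, sum_neg_distrib] at hsum
  have hone : ∑ k ∈ range (a + 1),
      (-1 : ℤ) ^ k * (a + 1).choose (k + 1) * (0 + k).choose 0 = 1 := by
    simp at hsum ⊢
    linarith
  rw [hone] at h
  simpa using h

theorem integral_genLaguerre_one_mul_pow_succ (a m : ℕ) :
    ∫ x in Set.Ioi (0 : ℝ), Real.exp (-x) * genLaguerre a 1 x * x ^ (m + 1)
      = (m + 1).factorial * ((-1) ^ a * m.choose a) := by
  have hsum := alternating_sum_choose_mul_choose_add (a + 1) (m + 1) m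
  rw [sum_range_succ'] at hsum
  have hmom : ∑ k ∈ range (a + 1),
      (-1 : ℤ) ^ k * (a + 1).choose (k + 1) * (m + 1 + k).choose (m + 1)
        = (-1) ^ a * m.choose a := by
    have hchoose : (if a + 1 ≤ m + 1 then (m.choose (m + 1 - (a + 1)) : ℤ) else 0)
        = m.choose a := by
      split_ifs with h
      · rw [Nat.succ_sub_succ, Nat.choose_symm (Nat.succ_le_succ_iff.1 h)]
      · rw [Nat.choose_eq_zero_of_lt (by omega), Nat.cast_zero]
    rw [hchoose] at hsum
    simp only [pow_succ, mul_neg_one, neg_mul, sum_neg_distrib, add_zero, Nat.choose_succ_self,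
      Nat.cast_zero, mul_zero, neg_inj] at hsum
    rw [← hsum]
    exact sum_congr rfl fun k _ ↦ by rw [add_right_comm, add_assoc]
  rw [integral_genLaguerre_one_mul_pow, hmom]
  push_cast
  ring

theorem integral_genLaguerre_one_mul_neg_two_add_two (a n : ℕ) :
    ∫ x in Set.Ioi (0 : ℝ), Real.exp (-x) * genLaguerre a 1 x * genLaguerre (n + 2) (-2) x
      = (if n = a then 1 else 0) - (if n + 1 = a then 1 else 0) := by
  have hexpand (x : ℝ) :
      Real.exp (-x) * genLaguerre a 1 x * genLaguerre (n + 2) (-2) x = ∑ k ∈ range (n + 1),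
        ((-1 : ℝ) ^ k / (k + 2).factorial * n.choose k) *
          (Real.exp (-x) * genLaguerre a 1 x * x ^ (k + 1 + 1)) := by
    rw [genLaguerre_neg_two_add_two, mul_sum]
    exact sum_congr rfl fun k _ ↦ by ring
  simp only [hexpand]
  rw [integral_finsetSum _ fun k _ ↦
    (integrableOn_genLaguerre_one_mul_pow a (k + 1 + 1)).const_mul _]
  simp only [integral_const_mul, integral_genLaguerre_one_mul_pow_succ]
  have hsum := congrArg (Int.cast : ℤ → ℝ) (alternating_sum_choose_mul_choose_add n a 1)
  push_cast at hsum
  have hfactor : ∑ k ∈ range (n + 1), ((-1 : ℝ) ^ k / (k + 2).factorial * n.choose k) *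
        ((k + 1 + 1).factorial * ((-1) ^ a * (k + 1).choose a))
      = (-1) ^ a * ∑ k ∈ range (n + 1), (-1 : ℝ) ^ k * n.choose k * (1 + k).choose a := by
    rw [mul_sum]
    refine sum_congr rfl fun k _ ↦ ?_
    rw [add_comm 1 k]
    field_simp
  rw [hfactor, hsum]
  rcases lt_or_ge a n with h | h
  · rw [if_neg (by omega), if_neg (by omega), if_neg (by omega)]
    simp
  · obtain ⟨d, rfl⟩ := Nat.exists_eq_add_of_le h
    have hsq : (-1 : ℝ) ^ n * (-1) ^ n = 1 := by rw [← mul_pow]; simp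
    rw [if_pos h, Nat.add_sub_cancel_left, pow_add]
    rcases d with _ | _ | d
    · simp [hsq]
    · simp [hsq]
    · rw [Nat.choose_eq_zero_of_lt (by omega), if_neg (by omega), if_neg (by omega)]
      simp

/-- `∫₀^∞ e^{−x}·L_a^{(1)}(x)·L_n^{(−2)}(x) dx
= δ_{n,0} − δ_{n,1} + δ_{n−2,a} − δ_{n−1,a}`. -/
theorem laguerre_integral_neg_two (a n : ℕ) :
    (∫ x in Set.Ioi (0 : ℝ), Real.exp (-x) * genLaguerre a 1 x * genLaguerre n (-2) x)
      = (if n = 0 then 1 else 0) - (if n = 1 then 1 else 0)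
        + (if (n : ℤ) - 2 = a then 1 else 0) - (if (n : ℤ) - 1 = a then 1 else 0) := by
  rcases n with _ | _ | n
  · have hzero (x : ℝ) : genLaguerre 0 (-2) x = 1 := by simp [genLaguerre]
    simp only [hzero, mul_one, integral_genLaguerre_one]
    have htwo : ((0 : ℕ) : ℤ) - 2 ≠ a := by omega
    have hone : ((0 : ℕ) : ℤ) - 1 ≠ a := by omega
    simp only [if_neg htwo, if_neg hone]
    norm_num
  · have hone (x : ℝ) : Real.exp (-x) * genLaguerre a 1 x * genLaguerre (0 + 1) (-2) x
        = -(Real.exp (-x) * genLaguerre a 1 x * x ^ 0)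
          - Real.exp (-x) * genLaguerre a 1 x * x ^ (0 + 1) := by
      simp [genLaguerre, sum_range_succ]
      ring
    simp only [hone]
    rw [integral_sub (Integrable.fun_neg (integrableOn_genLaguerre_one_mul_pow a 0))
      (integrableOn_genLaguerre_one_mul_pow a (0 + 1)), integral_neg,
      integral_genLaguerre_one_mul_pow_succ]
    simp only [pow_zero, mul_one, integral_genLaguerre_one]
    have htwo : ((0 + 1 : ℕ) : ℤ) - 2 ≠ a := by omega
    have hone : ((0 + 1 : ℕ) : ℤ) - 1 = a ↔ a = 0 := by omega
    simp only [if_neg htwo, hone]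
    rcases a with _ | a
    · norm_num
    · simp
  · rw [integral_genLaguerre_one_mul_neg_two_add_two]
    have htwo : ((n + 1 + 1 : ℕ) : ℤ) - 2 = a ↔ n = a := by omega
    have hone : ((n + 1 + 1 : ℕ) : ℤ) - 1 = a ↔ n + 1 = a := by omega
    simp only [htwo, hone]
    simp
end

section
/- For all m, n ∈ ℕ, the absolutely convergent double integral (1/2)·∫₀^∞∫₀^∞ e^{−(x+y)/2}·x·y·L_m(x)·L_n(y)·[F₁(xy/4) + F₂(xy/4)] dx dy equals (−1)^m·[2(m²+m+1)·δ_{m,n} − (m+1)(m+2)·δ_{m,n−2} − m(m−1)·δ_{m,n+2}], where F₁(z) := ∑_{k=0}^∞ (−z)^k/(k!)² and F₂(z) := ∑_{k=0}^∞ (−z)^k/(k!(k+1)!). (This is the two-body characteristic matrix Γ^{2bdy}_{mn}, which determines the long-wavelength graviton-mode gap δE = Γ^{2bdy}_{mn} c^m d^n for two-body interactions.) -/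
open MeasureTheory Finset

/-- The confluent hypergeometric limit function `₀F₁(;1;−z) = ∑_k (−z)^k/(k!)²`. -/
noncomputable def hypF₁ (z : ℝ) : ℝ := ∑' k : ℕ, (-z) ^ k / (k.factorial : ℝ) ^ 2

/-- The confluent hypergeometric limit function `₀F₁(;2;−z) = ∑_k (−z)^k/(k!(k+1)!)`. -/
noncomputable def hypF₂ (z : ℝ) : ℝ :=
  ∑' k : ℕ, (-z) ^ k / ((k.factorial : ℝ) * (k + 1).factorial)


theorem factorial_mul_prod_Icc_succ {k m : ℕ} (h : k ≤ m) :
    k.factorial * ∏ j ∈ Icc (k + 1) m, j = m.factorial := by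
  induction m, h using Nat.le_induction with
  | base => simp
  | succ m hkm ih =>
    rw [prod_Icc_succ_top (by omega), ← mul_assoc, ih, Nat.factorial_succ, mul_comm]

theorem genLaguerre_zero_eq (m : ℕ) (x : ℝ) :
    genLaguerre m 0 x = ∑ k ∈ range (m + 1), (-1 : ℝ) ^ k / k.factorial * m.choose k * x ^ k := by
  unfold genLaguerre
  refine sum_congr rfl fun k hk => ?_
  have hkm : k ≤ m := by simpa [Nat.lt_succ_iff] using hk
  have h : (k.factorial : ℝ) * ∏ j ∈ Icc (k + 1) m, ((j : ℕ) : ℝ) = m.factorial := by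
    rw [← factorial_mul_prod_Icc_succ hkm]
    push_cast
    rfl
  congr 2
  simp only [zero_add]
  rw [Nat.cast_choose ℝ hkm, ← h]
  field_simp

theorem integrableOn_pow_mul_exp {b : ℝ} (hb : 0 < b) (k : ℕ) :
    IntegrableOn (fun x : ℝ => Real.exp (-b * x) * x ^ k) (Set.Ioi 0) := by
  have h := integrableOn_rpow_mul_exp_neg_mul_rpow (p := 1) (s := k) (b := b)
    (by have : (0 : ℝ) ≤ k := k.cast_nonneg
        linarith) one_pos hb
  refine h.congr_fun (fun x _ => ?_) measurableSet_Ioi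
  simp [Real.rpow_natCast, mul_comm]

theorem integral_pow_mul_exp {b : ℝ} (hb : 0 < b) (k : ℕ) :
    ∫ x in Set.Ioi (0 : ℝ), Real.exp (-b * x) * x ^ k = k.factorial / b ^ (k + 1) := by
  have h := Real.integral_rpow_mul_exp_neg_mul_Ioi (a := (k : ℝ) + 1) (r := b) (by positivity) hb
  rw [Real.Gamma_nat_eq_factorial] at h
  calc _ = ∫ t in Set.Ioi (0 : ℝ), t ^ ((k : ℝ) + 1 - 1) * Real.exp (-(b * t)) := by
        refine setIntegral_congr_fun measurableSet_Ioi fun x _ => ?_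
        simp [Real.rpow_natCast, mul_comm]
    _ = _ := by
        rw [h, ← Nat.cast_succ, Real.rpow_natCast, one_div, inv_pow]
        field_simp

theorem sum_choose_mul_choose_mul_pow (a : ℝ) (n i : ℕ) :
    ∑ j ∈ range (n + 1), a ^ j * n.choose j * j.choose i
      = n.choose i * a ^ i * (1 + a) ^ (n - i) := by
  rcases lt_or_ge n i with h | h
  · rw [Nat.choose_eq_zero_of_lt h, sum_eq_zero]
    · simp
    · intro j hj
      rw [Nat.choose_eq_zero_of_lt (n := j) (by simp at hj; omega)]
      simp
  · obtain ⟨d, rfl⟩ := Nat.exists_eq_add_of_le h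
    rw [add_assoc, sum_range_add, sum_eq_zero, zero_add, Nat.add_sub_cancel_left, add_comm 1 a,
      add_pow, mul_sum]
    · refine sum_congr rfl fun l _ => ?_
      have := Nat.choose_mul (n := i + d) (k := i + l) (s := i) (by omega)
      simp only [Nat.add_sub_cancel_left] at this
      have h2 : ((i + d).choose (i + l) : ℝ) * (i + l).choose i
        = (i + d).choose i * d.choose l := by exact_mod_cast this
      rw [mul_assoc, h2, pow_add]
      ring
    · intro j hj
      rw [Nat.choose_eq_zero_of_lt (n := j) (by simpa using hj)]
      simp

theorem add_choose_eq_sum_range {n j : ℕ} (r : ℕ) (h : j ≤ n) :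
    (j + r).choose j = ∑ i ∈ range (n + 1), j.choose i * r.choose i := by
  rw [Nat.add_choose_eq, Nat.sum_antidiagonal_eq_sum_range_succ_mk, ← sum_range_reflect]
  symm
  refine (sum_subset (range_subset_range.2 (Nat.succ_le_succ h)) ?_).symm.trans
    (sum_congr rfl fun i hi => ?_)
  · intro i _ hi
    rw [Nat.choose_eq_zero_of_lt (n := j) (by simpa using hi), zero_mul]
  · have hij : i ≤ j := by simpa [Nat.lt_succ_iff] using hi
    simp only [Nat.succ_eq_add_one, Nat.add_sub_cancel]
    rw [Nat.choose_symm hij, Nat.sub_sub_self hij]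

theorem sum_choose_mul_add_choose_mul_pow (a : ℝ) (n r : ℕ) :
    ∑ j ∈ range (n + 1), a ^ j * n.choose j * (j + r).choose j
      = ∑ i ∈ range (n + 1), n.choose i * r.choose i * a ^ i * (1 + a) ^ (n - i) := by
  calc _ = ∑ j ∈ range (n + 1), ∑ i ∈ range (n + 1),
        a ^ j * n.choose j * (j.choose i) * r.choose i := by
        refine sum_congr rfl fun j hj => ?_
        rw [add_choose_eq_sum_range r (n := n) (by simpa [Nat.lt_succ_iff] using hj)]
        push_cast
        rw [mul_sum]
        exact sum_congr rfl fun i _ => by ring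
    _ = _ := by
        rw [sum_comm]
        refine sum_congr rfl fun i _ => ?_
        rw [← sum_mul, sum_choose_mul_choose_mul_pow]
        ring

theorem integrableOn_exp_mul_pow_mul_genLaguerre {b : ℝ} (hb : 0 < b) (m r : ℕ) :
    IntegrableOn (fun x : ℝ => Real.exp (-b * x) * x ^ r * genLaguerre m 0 x) (Set.Ioi 0) := by
  simp only [genLaguerre_zero_eq, mul_sum]
  refine integrable_finsetSum _ fun k _ => ?_
  refine ((integrableOn_pow_mul_exp hb (r + k)).const_mul
    ((-1 : ℝ) ^ k / k.factorial * m.choose k)).congr (.of_forall fun x => ?_)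
  simp only [pow_add]
  ring

theorem integral_exp_mul_pow_mul_genLaguerre {b : ℝ} (hb : 0 < b) (m r : ℕ) :
    ∫ x in Set.Ioi (0 : ℝ), Real.exp (-b * x) * x ^ r * genLaguerre m 0 x
      = r.factorial / b ^ (r + 1) *
        ∑ j ∈ range (m + 1), (-b⁻¹) ^ j * m.choose j * (j + r).choose j := by
  have hterm : ∀ k : ℕ, (fun x : ℝ => Real.exp (-b * x) * x ^ r *
      ((-1 : ℝ) ^ k / k.factorial * m.choose k * x ^ k)) =
      fun x => ((-1 : ℝ) ^ k / k.factorial * m.choose k) * (Real.exp (-b * x) * x ^ (r + k)) := by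
    intro k
    funext x
    rw [pow_add]
    ring
  simp only [genLaguerre_zero_eq, mul_sum]
  rw [integral_finsetSum]
  · refine sum_congr rfl fun k _ => ?_
    rw [hterm, integral_const_mul, integral_pow_mul_exp hb,
      Nat.cast_choose ℝ (Nat.le_add_right k r), Nat.add_sub_cancel_left, add_comm r k,
      neg_pow b⁻¹, inv_pow]
    field_simp
    ring
  · intro k _
    rw [hterm]
    exact (integrableOn_pow_mul_exp hb (r + k)).const_mul _

theorem integral_exp_neg_mul_pow_mul_genLaguerre (m r : ℕ) :
    ∫ x in Set.Ioi (0 : ℝ), Real.exp (-x) * x ^ r * genLaguerre m 0 x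
      = (-1) ^ m * r.factorial * r.choose m := by
  have h := integral_exp_mul_pow_mul_genLaguerre one_pos m r
  rw [inv_one, sum_choose_mul_add_choose_mul_pow, sum_eq_single m] at h
  · simp only [neg_mul, one_mul] at h
    rw [h]
    simp
    ring
  · intro i hi him
    have : m - i ≠ 0 := by simp at hi; omega
    simp [this]
  · simp

theorem integral_exp_half_mul_pow_mul_genLaguerre (n r : ℕ) :
    ∫ y in Set.Ioi (0 : ℝ), Real.exp (-y / 2) * y ^ r * genLaguerre n 0 y
      = (-1) ^ n * r.factorial * 2 ^ (r + 1) *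
        ∑ i ∈ range (n + 1), (2 : ℝ) ^ i * n.choose i * r.choose i := by
  have h := integral_exp_mul_pow_mul_genLaguerre (b := 1 / 2) (by norm_num) n r
  rw [sum_choose_mul_add_choose_mul_pow] at h
  have hexp : ∀ y : ℝ, -y / 2 = -(1 / 2) * y := fun y => by ring
  simp only [hexp]
  rw [h, mul_sum, mul_sum]
  refine sum_congr rfl fun i hi => ?_
  have hin : i ≤ n := by simpa [Nat.lt_succ_iff] using hi
  have h1 : (1 + -(1 / 2 : ℝ)⁻¹) = -1 := by norm_num
  have h2 : (-(1 / 2 : ℝ)⁻¹) = -1 * 2 := by norm_num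
  have h3 : (-1 : ℝ) ^ n = (-1) ^ i * (-1) ^ (n - i) := by
    rw [← pow_add, Nat.add_sub_cancel' hin]
  rw [h1, h2, h3, mul_pow, one_div, inv_pow, div_inv_eq_mul]
  ring

theorem hasSum_choose_mul_pow_div_factorial (u : ℝ) (r : ℕ) :
    HasSum (fun k : ℕ => (k.choose r : ℝ) * (u ^ k / k.factorial))
      (u ^ r / r.factorial * Real.exp u) := by
  rw [← (add_left_injective r).hasSum_iff]
  · have h := (NormedSpace.expSeries_div_hasSum_exp u).mul_left (u ^ r / r.factorial)
    rw [← Real.exp_eq_exp_ℝ] at h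
    refine h.congr_fun fun l => ?_
    simp only [Function.comp_apply]
    rw [Nat.cast_choose ℝ (Nat.le_add_left r l), Nat.add_sub_cancel, pow_add]
    field_simp
  · intro k hk
    rw [Nat.choose_eq_zero_of_lt, Nat.cast_zero, zero_mul]
    by_contra! hle
    exact hk ⟨k - r, Nat.sub_add_cancel hle⟩

theorem hasSum_add_two_choose_mul_pow_div_factorial (u : ℝ) (i : ℕ) :
    HasSum (fun k : ℕ => ((k + 2).choose (i + 1) : ℝ) * (u ^ k / k.factorial))
      ((u ^ (i + 1) / (i + 1).factorial + 2 * (u ^ i / i.factorial)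
        + i * (u ^ (i - 1) / i.factorial)) * Real.exp u) := by
  have h1 := hasSum_choose_mul_pow_div_factorial u (i + 1)
  have h0 := (hasSum_choose_mul_pow_div_factorial u i).mul_left 2
  rcases i with _ | i
  · convert h1.add h0 using 1
    · funext k
      simp
      ring
    · simp
      ring
  · convert (h1.add h0).add (hasSum_choose_mul_pow_div_factorial u i) using 1
    · funext k
      simp only [Nat.choose_succ_succ' (k + 1), Nat.choose_succ_succ' k]
      push_cast
      ring
    · simp only [Nat.add_sub_cancel, Nat.factorial_succ i]
      push_cast
      field_simp

theorem hasSum_hypF₁_add_hypF₂ (z : ℝ) :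
    HasSum (fun k : ℕ => ((k : ℝ) + 2) / (k.factorial * (k + 1).factorial) * (-z) ^ k)
      (hypF₁ z + hypF₂ z) := by
  have h1 : Summable fun k : ℕ => (-z) ^ k / (k.factorial : ℝ) ^ 2 := by
    refine .of_norm_bounded (Real.summable_pow_div_factorial |z|) fun k => ?_
    have : (1 : ℝ) ≤ k.factorial := by exact_mod_cast k.factorial_pos
    rw [norm_div, norm_pow, norm_neg, Real.norm_eq_abs,
      Real.norm_of_nonneg (sq_nonneg _)]
    gcongr
    nlinarith
  have h2 : Summable fun k : ℕ => (-z) ^ k / ((k.factorial : ℝ) * (k + 1).factorial) := by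
    refine .of_norm_bounded (Real.summable_pow_div_factorial |z|) fun k => ?_
    have h0 : (0 : ℝ) < k.factorial := by exact_mod_cast k.factorial_pos
    have : (1 : ℝ) ≤ (k + 1).factorial := by exact_mod_cast (k + 1).factorial_pos
    rw [norm_div, norm_pow, norm_neg, Real.norm_eq_abs,
      Real.norm_of_nonneg (by positivity)]
    gcongr
    nlinarith
  refine (h1.hasSum.add h2.hasSum).congr_fun fun k => ?_
  rw [Nat.factorial_succ]
  push_cast
  field_simp
  ring

theorem integral_norm_exp_mul_pow_mul_genLaguerre_le (n r : ℕ) :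
    ∫ y in Set.Ioi (0 : ℝ), ‖Real.exp (-(1 / 2) * y) * y ^ r * genLaguerre n 0 y‖
      ≤ r.factorial * 2 ^ (2 * r + 1) * ∑ j ∈ range (n + 1), (n.choose j : ℝ) * 4 ^ j := by
  have h_int := fun j => (integrableOn_pow_mul_exp (b := 1 / 2) (by norm_num) (r + j)).const_mul
    ((n.choose j : ℝ) / j.factorial)
  calc _ ≤ ∫ y in Set.Ioi (0 : ℝ), ∑ j ∈ range (n + 1),
        (n.choose j : ℝ) / j.factorial * (Real.exp (-(1 / 2) * y) * y ^ (r + j)) := by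
        refine setIntegral_mono_on
          (integrableOn_exp_mul_pow_mul_genLaguerre (by norm_num) n r).norm
          (integrable_finsetSum _ fun j _ => h_int j) measurableSet_Ioi fun y hy => ?_
        rw [genLaguerre_zero_eq, mul_sum]
        refine (norm_sum_le _ _).trans (sum_le_sum fun j _ => le_of_eq ?_)
        have hy' : |y| = y := abs_of_pos hy
        simp only [norm_mul, norm_div, norm_pow, Real.norm_eq_abs, Real.abs_exp, hy', abs_neg,
          abs_one, one_pow, Nat.abs_cast, pow_add]
        ring
    _ = ∑ j ∈ range (n + 1), (n.choose j : ℝ) / j.factorial *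
          ((r + j).factorial / (1 / 2) ^ (r + j + 1)) := by
        rw [integral_finsetSum _ fun j _ => h_int j]
        refine sum_congr rfl fun j _ => ?_
        rw [integral_const_mul, integral_pow_mul_exp (by norm_num)]
    _ ≤ _ := by
        rw [mul_sum]
        refine sum_le_sum fun j _ => ?_
        have h1 : ((r + j).factorial : ℝ) = (r + j).choose j * (j.factorial * r.factorial) := by
          rw [← Nat.add_choose_mul_factorial_mul_factorial]
          push_cast
          ring
        have h2 : ((r + j).choose j : ℝ) ≤ 2 ^ (r + j) := by
          exact_mod_cast Nat.choose_le_two_pow _ _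
        rw [h1]
        calc _ = (r + j).choose j * ((n.choose j : ℝ) * r.factorial * 2 ^ (r + j + 1)) := by
              rw [one_div, inv_pow]
              field_simp
          _ ≤ 2 ^ (r + j) * ((n.choose j : ℝ) * r.factorial * 2 ^ (r + j + 1)) := by gcongr
          _ = _ := by
              rw [show (4 : ℝ) = 2 ^ 2 by norm_num, ← pow_mul]
              ring

theorem integral_exp_mul_genLaguerre_mul_hypF (n : ℕ) (x : ℝ) :
    ∫ y in Set.Ioi (0 : ℝ), Real.exp (-y / 2) * y * genLaguerre n 0 y *
        (hypF₁ (x * y / 4) + hypF₂ (x * y / 4))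
      = 4 * (-1) ^ n * Real.exp (-x / 2) * ∑ i ∈ range (n + 1), 2 ^ i * n.choose i * (i + 1) *
          ((-x / 2) ^ (i + 1) / (i + 1).factorial + 2 * ((-x / 2) ^ i / i.factorial)
            + i * ((-x / 2) ^ (i - 1) / i.factorial)) := by
  set F : ℕ → ℝ → ℝ := fun k y => ((k : ℝ) + 2) / (k.factorial * (k + 1).factorial) *
    (-x / 4) ^ k * (Real.exp (-(1 / 2) * y) * y ^ (k + 1) * genLaguerre n 0 y) with hF
  have hexp : ∀ y : ℝ, -y / 2 = -(1 / 2) * y := fun y => by ring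
  have hsum_norm : Summable fun k => ∫ y in Set.Ioi (0 : ℝ), ‖F k y‖ := by
    set K := ∑ j ∈ range (n + 1), (n.choose j : ℝ) * 4 ^ j
    have hK : 0 ≤ K := by positivity
    refine .of_nonneg_of_le (fun k => integral_nonneg fun y => norm_nonneg _) (fun k => ?_)
      ((Real.summable_pow_div_factorial (2 * |x|)).mul_left (16 * K))
    simp only [hF, norm_mul (_ * _) (_ * _ * _)]
    rw [integral_const_mul]
    refine (mul_le_mul_of_nonneg_left (integral_norm_exp_mul_pow_mul_genLaguerre_le n (k + 1))
      (norm_nonneg _)).trans ?_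
    change _ * (_ * K) ≤ _
    have hk : (k : ℝ) + 2 ≤ 2 * 2 ^ k := by
      have h : k + 1 ≤ 2 ^ k := Nat.lt_two_pow_self
      have h' : (k : ℝ) + 1 ≤ 2 ^ k := by exact_mod_cast h
      have : (1 : ℝ) ≤ 2 ^ k := one_le_pow₀ (by norm_num)
      linarith
    rw [norm_mul, norm_pow, norm_div, norm_div, norm_neg, Real.norm_eq_abs x,
      Real.norm_of_nonneg (by positivity : (0 : ℝ) ≤ k + 2),
      Real.norm_of_nonneg (by positivity : (0 : ℝ) ≤ k.factorial * (k + 1).factorial),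
      Real.norm_of_nonneg (by norm_num : (0 : ℝ) ≤ 4)]
    calc _ = ((k : ℝ) + 2) * (8 * K * |x| ^ k / k.factorial) := by
          rw [show 2 * (k + 1) + 1 = 2 * k + 3 by ring, pow_add, pow_mul, div_pow]
          norm_num
          field_simp
      _ ≤ 2 * 2 ^ k * (8 * K * |x| ^ k / k.factorial) := by gcongr
      _ = _ := by
          rw [mul_pow]
          ring
  have hmain := hasSum_integral_of_summable_integral_norm (F := F)
    (μ := volume.restrict (Set.Ioi 0))
    (fun k => (integrableOn_exp_mul_pow_mul_genLaguerre (by norm_num) n (k + 1)).const_mul _)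
    hsum_norm
  have hval : HasSum (fun k => ∫ y in Set.Ioi (0 : ℝ), F k y)
      (4 * (-1) ^ n * Real.exp (-x / 2) * ∑ i ∈ range (n + 1), 2 ^ i * n.choose i * (i + 1) *
          ((-x / 2) ^ (i + 1) / (i + 1).factorial + 2 * ((-x / 2) ^ i / i.factorial)
            + i * ((-x / 2) ^ (i - 1) / i.factorial))) := by
    have h := (hasSum_sum fun i (_ : i ∈ range (n + 1)) =>
      (hasSum_add_two_choose_mul_pow_div_factorial (-x / 2) i).mul_left
        (2 ^ i * n.choose i * ((i : ℝ) + 1))).mul_left (4 * (-1) ^ n)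
    rw [mul_assoc (4 * (-1) ^ n), mul_sum _ _ (Real.exp _)]
    simp only [mul_comm (Real.exp (-x / 2)), mul_assoc (_ * (_ + 1 : ℝ))]
    refine h.congr_fun fun k => ?_
    simp only [hF]
    rw [integral_const_mul]
    simp only [← hexp]
    rw [integral_exp_half_mul_pow_mul_genLaguerre, mul_sum, mul_sum, mul_sum]
    refine sum_congr rfl fun i _ => ?_
    have hc : ((k : ℝ) + 2) * (k + 1).choose i = (k + 2).choose (i + 1) * (i + 1) := by
      exact_mod_cast Nat.add_one_mul_choose_eq (k + 1) i
    have hx : (-x / 4) ^ k * 2 ^ (k + 1 + 1) = 4 * (-x / 2) ^ k := by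
      rw [pow_add _ (k + 1), pow_add, mul_assoc, ← mul_assoc, ← mul_assoc, ← mul_pow]
      ring
    calc _ = (((k : ℝ) + 2) * (k + 1).choose i) * ((-x / 4) ^ k * 2 ^ (k + 1 + 1)) *
          ((-1) ^ n * 2 ^ i * n.choose i / k.factorial) := by
          field_simp
      _ = _ := by
          rw [hc, hx]
          ring
  rw [← hmain.unique hval]
  refine integral_congr_ae (.of_forall fun y => ?_)
  have h := (hasSum_hypF₁_add_hypF₂ (x * y / 4)).mul_left
    (Real.exp (-y / 2) * y * genLaguerre n 0 y)
  simp only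
  rw [← h.tsum_eq]
  refine tsum_congr fun k => ?_
  simp only [hF]
  rw [hexp, show -(x * y / 4) = -x / 4 * y by ring, mul_pow, pow_succ]
  ring

/-- Binomial coefficients extended by zero to negative lower index. -/
def intChoose (n : ℕ) (z : ℤ) : ℝ := if z < 0 then 0 else n.choose z.toNat

theorem intChoose_natCast (n k : ℕ) : intChoose n k = n.choose k := by
  simp [intChoose]

theorem intChoose_of_neg (n : ℕ) {z : ℤ} (hz : z < 0) : intChoose n z = 0 := if_pos hz

theorem intChoose_succ (n : ℕ) (z : ℤ) :
    intChoose (n + 1) z = intChoose n z + intChoose n (z - 1) := by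
  rcases lt_or_ge z 0 with h | h
  · simp [intChoose_of_neg _ h, intChoose_of_neg n (show z - 1 < 0 by omega)]
  · lift z to ℕ using h
    rcases z with _ | k
    · rw [intChoose_of_neg n (show ((0 : ℕ) : ℤ) - 1 < 0 by norm_num), intChoose_natCast,
        intChoose_natCast]
      simp
    · rw [Nat.cast_succ, add_sub_cancel_right, ← Nat.cast_succ, intChoose_natCast,
        intChoose_natCast, intChoose_natCast, Nat.choose_succ_succ']
      push_cast
      ring

theorem natCast_mul_intChoose (n : ℕ) (z : ℤ) :
    n * intChoose n z = (z + 1) * intChoose n (z + 1) + z * intChoose n z := by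
  rcases lt_or_ge z 0 with h | h
  · rcases eq_or_ne z (-1) with rfl | h1
    · simp [intChoose_of_neg]
    · simp [intChoose_of_neg _ h, intChoose_of_neg n (show z + 1 < 0 by omega)]
  · lift z to ℕ using h
    rw [← Nat.cast_succ, intChoose_natCast, intChoose_natCast]
    have h1 : ((n : ℝ) + 1) * n.choose z = (n + 1).choose (z + 1) * (z + 1) := by
      exact_mod_cast Nat.add_one_mul_choose_eq n z
    rw [Nat.choose_succ_succ'] at h1
    push_cast at h1 ⊢
    linarith

theorem sum_neg_one_pow_mul_choose_mul_intChoose (n : ℕ) (z : ℤ) :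
    ∑ i ∈ range (n + 1), (-1 : ℝ) ^ i * n.choose i * intChoose i z
      = (-1) ^ n * (if (n : ℤ) = z then 1 else 0) := by
  rcases lt_or_ge z 0 with h | h
  · rw [if_neg (by omega)]
    simp [intChoose_of_neg _ h]
  · lift z to ℕ using h
    simp only [intChoose_natCast, sum_choose_mul_choose_mul_pow, Nat.cast_inj]
    split_ifs with hz
    · simp [hz]
    · rcases lt_or_ge n z with h | h
      · simp [Nat.choose_eq_zero_of_lt h]
      · have : n - z ≠ 0 := by omega
        simp [this]

theorem add_one_mul_choose_combination (i m : ℕ) :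
    ((i : ℝ) + 1) * (-(1 / 2) * (i + 2) * (i + 2).choose m + 2 * (i + 1) * (i + 1).choose m
        - 2 * i * i.choose m)
      = (m ^ 2 + m + 1) * intChoose i m - (m + 1) * (m + 2) / 2 * intChoose i (m + 2)
        - m * (m - 1) / 2 * intChoose i (m - 2) := by
  have h0 := natCast_mul_intChoose i m
  have h1 := natCast_mul_intChoose i (m + 1)
  have hm1 := natCast_mul_intChoose i (m - 1)
  have hm2 := natCast_mul_intChoose i (m - 2)
  rw [show (m : ℤ) + 1 + 1 = m + 2 by ring] at h1
  rw [show (m : ℤ) - 1 + 1 = m by ring] at hm1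
  rw [show (m : ℤ) - 2 + 1 = m - 1 by ring] at hm2
  simp only [← intChoose_natCast, intChoose_succ (i + 1), intChoose_succ i]
  rw [show (m : ℤ) - 1 - 1 = m - 2 by ring]
  push_cast at h0 h1 hm1 hm2
  linear_combination (-(1 / 2) * (i : ℝ) + 1 / 2 + m / 2) * h0 + (-(m + 1) / 2 : ℝ) * h1
    + ((i : ℝ) + 1 + (m - 1) / 2) * hm1 + (-(1 / 2) * (i : ℝ) - 3 / 2 - (m - 2) / 2) * hm2

theorem integrable_and_integral_genLaguerre_mul_transform (m i : ℕ) :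
    IntegrableOn (fun x : ℝ => Real.exp (-x) * x * genLaguerre m 0 x *
        ((-x / 2) ^ (i + 1) / (i + 1).factorial + 2 * ((-x / 2) ^ i / i.factorial)
            + i * ((-x / 2) ^ (i - 1) / i.factorial))) (Set.Ioi 0) ∧
    ∫ x in Set.Ioi (0 : ℝ), Real.exp (-x) * x * genLaguerre m 0 x *
        ((-x / 2) ^ (i + 1) / (i + 1).factorial + 2 * ((-x / 2) ^ i / i.factorial)
            + i * ((-x / 2) ^ (i - 1) / i.factorial))
      = (-1) ^ m * (-1 / 2) ^ i * (-(1 / 2) * (i + 2) * (i + 2).choose m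
        + 2 * (i + 1) * (i + 1).choose m - 2 * i * i.choose m) := by
  have h_int : ∀ r, IntegrableOn (fun x : ℝ => Real.exp (-x) * x ^ r * genLaguerre m 0 x)
      (Set.Ioi 0) := fun r => by
    simpa using integrableOn_exp_mul_pow_mul_genLaguerre one_pos m r
  have heq : (fun x : ℝ => Real.exp (-x) * x * genLaguerre m 0 x *
        ((-x / 2) ^ (i + 1) / (i + 1).factorial + 2 * ((-x / 2) ^ i / i.factorial)
            + i * ((-x / 2) ^ (i - 1) / i.factorial))) = fun x =>
      (-1 / 2) ^ (i + 1) / (i + 1).factorial *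
          (Real.exp (-x) * x ^ (i + 2) * genLaguerre m 0 x)
        + 2 * (-1 / 2) ^ i / i.factorial * (Real.exp (-x) * x ^ (i + 1) * genLaguerre m 0 x)
        + -2 * i * (-1 / 2) ^ i / i.factorial * (Real.exp (-x) * x ^ i * genLaguerre m 0 x) := by
    funext x
    have hx : -x / 2 = -1 / 2 * x := by ring
    rcases i with _ | i
    · simp
      ring
    · rw [hx, Nat.add_sub_cancel, mul_pow, mul_pow, mul_pow]
      ring
  rw [heq]
  have i2 := (h_int (i + 2)).const_mul ((-1 / 2 : ℝ) ^ (i + 1) / (i + 1).factorial)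
  have i1 := (h_int (i + 1)).const_mul (2 * (-1 / 2 : ℝ) ^ i / i.factorial)
  have i0 := (h_int i).const_mul (-2 * i * (-1 / 2 : ℝ) ^ i / i.factorial)
  refine ⟨(i2.add i1).add i0, ?_⟩
  have h := integral_add (i2.add i1) i0
  simp only [Pi.add_apply] at h
  rw [h, integral_add i2 i1, integral_const_mul, integral_const_mul, integral_const_mul]
  simp only [integral_exp_neg_mul_pow_mul_genLaguerre, Nat.factorial_succ]
  push_cast
  field_simp
  ring

/-- the two-body characteristic matrix `Γ^{2bdy}_{mn}` as a double
integral, evaluated in closed form. -/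
theorem twobody_characteristic_matrix_integral (m n : ℕ) :
    (1 / 2 : ℝ) * (∫ x in Set.Ioi (0 : ℝ), ∫ y in Set.Ioi (0 : ℝ),
        Real.exp (-(x + y) / 2) * x * y * genLaguerre m 0 x * genLaguerre n 0 y *
          (hypF₁ (x * y / 4) + hypF₂ (x * y / 4)))
      = (-1 : ℝ) ^ m *
          (2 * (m ^ 2 + m + 1) * (if m = n then 1 else 0)
            - (m + 1) * (m + 2) * (if (m : ℤ) = (n : ℤ) - 2 then 1 else 0)
            - m * (m - 1) * (if (m : ℤ) = (n : ℤ) + 2 then 1 else 0)) := by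
  have hinner : ∀ x : ℝ, ∫ y in Set.Ioi (0 : ℝ),
      Real.exp (-(x + y) / 2) * x * y * genLaguerre m 0 x * genLaguerre n 0 y *
          (hypF₁ (x * y / 4) + hypF₂ (x * y / 4))
      = ∑ i ∈ range (n + 1), 4 * (-1) ^ n * (2 ^ i * n.choose i * (i + 1)) *
        (Real.exp (-x) * x * genLaguerre m 0 x *
          ((-x / 2) ^ (i + 1) / (i + 1).factorial + 2 * ((-x / 2) ^ i / i.factorial)
            + i * ((-x / 2) ^ (i - 1) / i.factorial))) := by
    intro x
    have hexp : Real.exp (-x) = Real.exp (-x / 2) * Real.exp (-x / 2) := by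
      rw [← Real.exp_add, add_halves]
    calc _ = ∫ y in Set.Ioi (0 : ℝ), (Real.exp (-x / 2) * x * genLaguerre m 0 x) *
          (Real.exp (-y / 2) * y * genLaguerre n 0 y *
            (hypF₁ (x * y / 4) + hypF₂ (x * y / 4))) := by
          refine integral_congr_ae (.of_forall fun y => ?_)
          simp only
          rw [show -(x + y) / 2 = -x / 2 + -y / 2 by ring, Real.exp_add]
          ring
      _ = _ := by
          rw [integral_const_mul, integral_exp_mul_genLaguerre_mul_hypF, hexp, mul_sum, mul_sum]
          exact sum_congr rfl fun i _ => by ring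
  simp only [hinner]
  rw [integral_finsetSum _ fun i _ =>
    (integrable_and_integral_genLaguerre_mul_transform m i).1.const_mul _]
  have hterm : ∀ i : ℕ, ∫ x in Set.Ioi (0 : ℝ), 4 * (-1) ^ n * (2 ^ i * n.choose i * (i + 1)) *
        (Real.exp (-x) * x * genLaguerre m 0 x *
          ((-x / 2) ^ (i + 1) / (i + 1).factorial + 2 * ((-x / 2) ^ i / i.factorial)
            + i * ((-x / 2) ^ (i - 1) / i.factorial)))
      = 4 * (-1) ^ n * (-1) ^ m *
        ((m ^ 2 + m + 1) * ((-1) ^ i * n.choose i * intChoose i m)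
        - (m + 1) * (m + 2) / 2 * ((-1) ^ i * n.choose i * intChoose i (m + 2))
        - m * (m - 1) / 2 * ((-1) ^ i * n.choose i * intChoose i (m - 2))) := by
    intro i
    rw [integral_const_mul, (integrable_and_integral_genLaguerre_mul_transform m i).2]
    have h2 : (2 : ℝ) ^ i * (-1 / 2) ^ i = (-1) ^ i := by rw [← mul_pow]; norm_num
    linear_combination 4 * (-1) ^ n * (-1) ^ m * (-1) ^ i * n.choose i *
      add_one_mul_choose_combination i m + 4 * (-1) ^ n * (-1) ^ m * n.choose i * ((i : ℝ) + 1) *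
      (-(1 / 2) * (i + 2) * (i + 2).choose m + 2 * (i + 1) * (i + 1).choose m
        - 2 * i * i.choose m) * h2
  simp only [hterm, ← mul_sum, sum_sub_distrib, sum_neg_one_pow_mul_choose_mul_intChoose]
  have hsq : ((-1 : ℝ) ^ n) * (-1) ^ n = 1 := by rw [← mul_pow]; norm_num
  have e0 : (n : ℤ) = m ↔ m = n := by omega
  have e2 : (n : ℤ) = m + 2 ↔ (m : ℤ) = n - 2 := by omega
  have em2 : (n : ℤ) = m - 2 ↔ (m : ℤ) = n + 2 := by omega
  simp only [e0, e2, em2]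
  linear_combination ((-1 : ℝ) ^ m *
          (2 * (m ^ 2 + m + 1) * (if m = n then 1 else 0)
            - (m + 1) * (m + 2) * (if (m : ℤ) = (n : ℤ) - 2 then 1 else 0)
            - m * (m - 1) * (if (m : ℤ) = (n : ℤ) + 2 then 1 else 0))) * hsq
end

section
/- (Hardy–Hille formula) For every α ∈ ℕ, all real x, y ≥ 0 and every real t with |t| < 1, ∑_{n=0}^∞ (n!·α!/(n+α)!)·L_n^{(α)}(x)·L_n^{(α)}(y)·t^n = (1−t)^{−(α+1)}·exp(−(x+y)·t/(1−t))·∑_{k=0}^∞ (α!/(k!·(k+α)!))·(x·y·t/(1−t)²)^k, both series being absolutely convergent. -/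
open Finset

/-- Vandermonde's identity as a sum over a range. -/
theorem choose_add_eq_sum_range (m n r : ℕ) :
    (m + n).choose r = ∑ i ∈ range (r + 1), m.choose i * n.choose (r - i) := by
  rw [Nat.add_choose_eq,
    Finset.Nat.sum_antidiagonal_eq_sum_range_succ fun a b => m.choose a * n.choose b]

theorem sum_choose_mul_choose_mul_choose (α j k i : ℕ) (hi : i ≤ j) :
    ∑ m ∈ range (j + 1), k.choose m * (α + j).choose (α + m) * m.choose i =
      k.choose i * (α + j + k - i).choose (j - i) := by
  obtain ⟨d, rfl⟩ := Nat.exists_eq_add_of_le hi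
  rcases lt_or_ge k i with hk | hk
  · rw [Nat.choose_eq_zero_of_lt hk, zero_mul]
    refine sum_eq_zero fun m _ => ?_
    rcases lt_or_ge m i with h | h
    · simp [Nat.choose_eq_zero_of_lt h]
    · simp [Nat.choose_eq_zero_of_lt (hk.trans_le h)]
  · obtain ⟨e, rfl⟩ := Nat.exists_eq_add_of_le hk
    have h0 : ∑ m ∈ range i, (i + e).choose m * (α + (i + d)).choose (α + m) * m.choose i = 0 :=
      sum_eq_zero fun m hm => by simp [Nat.choose_eq_zero_of_lt (mem_range.1 hm)]
    rw [add_assoc i d 1, sum_range_add, h0, zero_add,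
      show α + (i + d) + (i + e) - i = e + (α + (i + d)) by omega,
      show i + d - i = d by omega, choose_add_eq_sum_range e, mul_sum]
    refine sum_congr rfl fun l hl => ?_
    have hl' : l ≤ d := Nat.lt_succ_iff.1 (mem_range.1 hl)
    have h1 := Nat.choose_mul (n := i + e) (Nat.le_add_right i l)
    rw [show i + e - i = e by omega, show i + l - i = l by omega] at h1
    rw [Nat.choose_symm_of_eq_add (show α + (i + d) = (α + (i + l)) + (d - l) by omega),
      mul_right_comm, h1, mul_assoc]

/-- A form of Nanjundiah's product formula for binomial coefficients. -/
theorem choose_mul_choose_eq_sum (α j k n : ℕ) :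
    n.choose j * (n + α).choose (α + k) =
      ∑ m ∈ range (j + 1),
        k.choose m * (α + j).choose (α + m) * (n + α + m).choose (α + j + k) := by
  have expand : ∀ m ∈ range (j + 1), (n + α + m).choose (α + j + k) =
      ∑ i ∈ range (j + 1), m.choose i * (n + α).choose (α + j + k - i) := by
    intro m hm
    rw [add_comm (n + α) m, choose_add_eq_sum_range]
    refine (sum_subset (range_subset_range.2 (by omega)) fun i _ hi => ?_).symm
    simp only [mem_range] at hm hi
    rw [Nat.choose_eq_zero_of_lt (by omega), zero_mul]
  have inner : ∀ i ∈ range (j + 1),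
      ∑ m ∈ range (j + 1), k.choose m * (α + j).choose (α + m) *
          (m.choose i * (n + α).choose (α + j + k - i)) =
        (k.choose i * (n - k).choose (j - i)) * (n + α).choose (α + k) := by
    intro i hi
    have hi' : i ≤ j := Nat.lt_succ_iff.1 (mem_range.1 hi)
    simp only [← mul_assoc]
    rw [← sum_mul, sum_choose_mul_choose_mul_choose α j k i hi']
    have h := Nat.choose_mul (n := n + α) (show α + k ≤ α + j + k - i by omega)
    rw [show n + α - (α + k) = n - k by omega,
      show α + j + k - i - (α + k) = j - i by omega,
      Nat.choose_symm_of_eq_add (show α + j + k - i = (α + k) + (j - i) by omega)] at h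
    linear_combination k.choose i * h
  rw [sum_congr rfl fun m hm => by rw [expand m hm, mul_sum], sum_comm, sum_congr rfl inner,
    ← sum_mul, ← choose_add_eq_sum_range]
  rcases le_or_gt k n with hk | hk
  · rw [Nat.add_sub_cancel' hk]
  · rw [Nat.choose_eq_zero_of_lt (show n + α < α + k by omega), mul_zero, mul_zero]

/-- The contribution of `x ^ p.1 * y ^ p.2 * t ^ n` to the left side of the Hardy–Hille formula. -/
noncomputable def laguerreTerm (α : ℕ) (x y t : ℝ) (p : ℕ × ℕ) (n : ℕ) : ℝ :=
  (α.factorial : ℝ) * (-x) ^ p.1 * (-y) ^ p.2 / ((α + p.1).factorial * p.2.factorial) *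
    (n.choose p.1 * (n + α).choose (α + p.2)) * t ^ n

/-- The contribution of the `m`-th term of the `₀F₁` series to the coefficient of
`x ^ p.1 * y ^ p.2` on the right side of the Hardy–Hille formula. -/
noncomputable def hilleTerm (α : ℕ) (x y t : ℝ) (p : ℕ × ℕ) (m : ℕ) : ℝ :=
  (α.factorial : ℝ) * (-x) ^ p.1 * (-y) ^ p.2 / ((α + p.1).factorial * p.2.factorial) *
    (p.2.choose m * (α + p.1).choose (α + m)) *
      (t ^ (p.1 + p.2 - m) / (1 - t) ^ (α + p.1 + p.2 + 1))

theorem hasSum_shifted_choose_mul_geometric (α m d : ℕ) {t : ℝ} (ht : |t| < 1) :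
    HasSum (fun n : ℕ => ((n + α + m).choose (α + m + d) : ℝ) * t ^ n)
      (t ^ d / (1 - t) ^ (α + m + d + 1)) := by
  rw [← hasSum_nat_add_iff' d, sum_eq_zero, sub_zero]
  · have h := (hasSum_choose_mul_geometric_of_norm_lt_one (𝕜 := ℝ) (α + m + d) ht).mul_left (t ^ d)
    rw [mul_one_div] at h
    refine h.congr_fun fun n => ?_
    rw [show n + d + α + m = n + (α + m + d) by ring, pow_add]
    ring
  · intro n hn
    rw [Nat.choose_eq_zero_of_lt (by have := mem_range.1 hn; omega)]
    simp

theorem hasSum_laguerreTerm_right (α : ℕ) (x y : ℝ) {t : ℝ} (ht : |t| < 1) (p : ℕ × ℕ) :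
    HasSum (laguerreTerm α x y t p) (∑ m ∈ range (p.1 + 1), hilleTerm α x y t p m) := by
  obtain ⟨j, k⟩ := p
  have key : ∀ m ∈ range (j + 1), HasSum (fun n : ℕ =>
      (α.factorial : ℝ) * (-x) ^ j * (-y) ^ k / ((α + j).factorial * k.factorial) *
        (k.choose m * (α + j).choose (α + m)) *
          ((n + α + m).choose (α + j + k) * t ^ n)) (hilleTerm α x y t (j, k) m) := by
    intro m hm
    have hm' : m ≤ j := Nat.lt_succ_iff.1 (mem_range.1 hm)
    have h := hasSum_shifted_choose_mul_geometric α m (j + k - m) ht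
    rw [show α + m + (j + k - m) = α + j + k by omega] at h
    exact h.mul_left _
  refine (hasSum_sum key).congr_fun fun n => ?_
  have h : (n.choose j * (n + α).choose (α + k) : ℝ) = ∑ m ∈ range (j + 1),
      (k.choose m * (α + j).choose (α + m) * (n + α + m).choose (α + j + k) : ℝ) := by
    exact_mod_cast choose_mul_choose_eq_sum α j k n
  rw [laguerreTerm, h, mul_sum, sum_mul]
  exact sum_congr rfl fun m _ => by ring

theorem hilleTerm_eq_zero {α : ℕ} {x y t : ℝ} {p : ℕ × ℕ} {m : ℕ} (h : p.1 < m ∨ p.2 < m) :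
    hilleTerm α x y t p m = 0 := by
  rcases h with h | h
  · simp [hilleTerm, Nat.choose_eq_zero_of_lt (show α + p.1 < α + m by omega)]
  · simp [hilleTerm, Nat.choose_eq_zero_of_lt h]

theorem hilleTerm_add (α : ℕ) (x y : ℝ) {t : ℝ} (ht : t ≠ 1) (a b m : ℕ) :
    hilleTerm α x y t (a + m, b + m) m =
      (1 - t) ^ (-(α + 1 : ℤ)) *
        ((-x * t / (1 - t)) ^ a / a.factorial * ((-y * t / (1 - t)) ^ b / b.factorial) *
          ((α.factorial : ℝ) / (m.factorial * (m + α).factorial) *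
            (x * y * t / (1 - t) ^ 2) ^ m)) := by
  have h1 : (1 - t) ≠ 0 := sub_ne_zero.2 ht.symm
  have hz : (1 - t) ^ (-(α + 1 : ℤ)) = ((1 - t) ^ (α + 1))⁻¹ := by
    rw [zpow_neg]; norm_cast
  have hb : ((b + m).choose m : ℝ) = (b + m).factorial / (b.factorial * m.factorial) := by
    rw [Nat.choose_symm_add.symm, Nat.cast_add_choose]
  have ha : ((α + (a + m)).choose (α + m) : ℝ) =
      (α + (a + m)).factorial / ((m + α).factorial * a.factorial) := by
    rw [show α + (a + m) = (m + α) + a by ring, add_comm α m, Nat.cast_add_choose]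
  have hxy : (-x) ^ (a + m) * (-y) ^ (b + m) = (-x) ^ a * (-y) ^ b * (x * y) ^ m := by
    rw [pow_add, pow_add, ← neg_mul_neg x y, mul_pow]; ring
  simp only [hilleTerm]
  rw [hz, hb, ha, mul_assoc (α.factorial : ℝ), hxy, show a + m + (b + m) - m = a + b + m by omega,
    div_pow, div_pow, div_pow, mul_pow (-x), mul_pow (-y), mul_pow _ t m, ← pow_mul]
  have h2 := Nat.cast_ne_zero (R := ℝ).2 (α + (a + m)).factorial_ne_zero
  have h3 := Nat.cast_ne_zero (R := ℝ).2 (b + m).factorial_ne_zero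
  have h4 := Nat.cast_ne_zero (R := ℝ).2 (m + α).factorial_ne_zero
  field_simp
  ring

theorem summable_hypergeometric_zero_one (α : ℕ) (z : ℝ) :
    Summable fun k : ℕ => |(α.factorial : ℝ) / (k.factorial * (k + α).factorial) * z ^ k| := by
  refine ((Real.summable_pow_div_factorial |z|).mul_left (α.factorial : ℝ)).of_nonneg_of_le
    (fun _ => abs_nonneg _) fun k => ?_
  rw [abs_mul, abs_pow, abs_of_nonneg (by positivity), ← mul_div_assoc, div_mul_eq_mul_div]
  gcongr
  exact le_mul_of_one_le_right (by positivity)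
    (by exact_mod_cast Nat.one_le_iff_ne_zero.2 (Nat.factorial_ne_zero _))

theorem Real.hasSum_pow_div_factorial (u : ℝ) :
    HasSum (fun n : ℕ => u ^ n / n.factorial) (Real.exp u) := by
  rw [Real.exp_eq_exp_ℝ]
  exact NormedSpace.expSeries_div_hasSum_exp u

theorem Real.hasSum_mul {ι κ : Type*} {f : ι → ℝ} {g : κ → ℝ} {a b : ℝ}
    (hf : HasSum f a) (hg : HasSum g b) : HasSum (fun p : ι × κ => f p.1 * g p.2) (a * b) :=
  hf.mul hg (summable_mul_of_summable_norm hf.summable.norm hg.summable.norm)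

theorem hasSum_hilleTerm (α : ℕ) (x y : ℝ) {t : ℝ} (ht : t ≠ 1) :
    HasSum (fun q : (ℕ × ℕ) × ℕ => hilleTerm α x y t q.1 q.2)
      ((1 - t) ^ (-(α + 1 : ℤ)) * Real.exp (-(x + y) * t / (1 - t)) *
        ∑' k : ℕ, (α.factorial : ℝ) / (k.factorial * (k + α).factorial) *
          (x * y * t / (1 - t) ^ 2) ^ k) := by
  have hF := (summable_hypergeometric_zero_one α (x * y * t / (1 - t) ^ 2)).of_abs.hasSum
  have hE := Real.hasSum_mul (Real.hasSum_pow_div_factorial (-x * t / (1 - t)))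
    (Real.hasSum_pow_div_factorial (-y * t / (1 - t)))
  have hP := (Real.hasSum_mul hE hF).mul_left ((1 - t) ^ (-(α + 1 : ℤ)))
  rw [← Real.exp_add, show -x * t / (1 - t) + -y * t / (1 - t) = -(x + y) * t / (1 - t) by ring,
    ← mul_assoc] at hP
  let g : (ℕ × ℕ) × ℕ → (ℕ × ℕ) × ℕ := fun q => ((q.1.1 + q.2, q.1.2 + q.2), q.2)
  have hg : Function.Injective g := by
    rintro ⟨⟨a, b⟩, m⟩ ⟨⟨a', b'⟩, m'⟩ h
    simp only [g, Prod.mk.injEq] at h ⊢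
    omega
  refine (hg.hasSum_iff ?_).1 (hP.congr_fun fun q => hilleTerm_add α x y ht q.1.1 q.1.2 q.2)
  rintro ⟨⟨j, k⟩, m⟩ hq
  refine hilleTerm_eq_zero ?_
  by_contra! h
  exact hq ⟨((j - m, k - m), m), by simp [g, h.1, h.2]⟩

theorem hasSum_sum_hilleTerm (α : ℕ) (x y : ℝ) {t : ℝ} (ht : t ≠ 1) :
    HasSum (fun p : ℕ × ℕ => ∑ m ∈ range (p.1 + 1), hilleTerm α x y t p m)
      ((1 - t) ^ (-(α + 1 : ℤ)) * Real.exp (-(x + y) * t / (1 - t)) *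
        ∑' k : ℕ, (α.factorial : ℝ) / (k.factorial * (k + α).factorial) *
          (x * y * t / (1 - t) ^ 2) ^ k) :=
  (hasSum_hilleTerm α x y ht).prod_fiberwise fun p =>
    hasSum_sum_of_ne_finset_zero fun m hm => hilleTerm_eq_zero (.inl (by simpa using hm))

theorem abs_laguerreTerm (α : ℕ) (x y t : ℝ) (p : ℕ × ℕ) (n : ℕ) :
    |laguerreTerm α x y t p n| = laguerreTerm α (-|x|) (-|y|) |t| p n := by
  simp [laguerreTerm, abs_mul, abs_div, abs_pow]

theorem summable_laguerreTerm (α : ℕ) (x y : ℝ) {t : ℝ} (ht : |t| < 1) :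
    Summable fun q : (ℕ × ℕ) × ℕ => laguerreTerm α x y t q.1 q.2 := by
  refine Summable.of_abs ?_
  have ht' : |(|t|)| < 1 := by rwa [abs_abs]
  have h := hasSum_laguerreTerm_right α (-|x|) (-|y|) ht'
  rw [summable_prod_of_nonneg fun _ => abs_nonneg _]
  simp only [abs_laguerreTerm]
  refine ⟨fun p => (h p).summable, ?_⟩
  simp only [(h _).tsum_eq]
  exact (hasSum_sum_hilleTerm α _ _ ht.ne).summable

theorem hasSum_laguerreTerm (α : ℕ) (x y : ℝ) {t : ℝ} (ht : |t| < 1) :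
    HasSum (fun q : (ℕ × ℕ) × ℕ => laguerreTerm α x y t q.1 q.2)
      ((1 - t) ^ (-(α + 1 : ℤ)) * Real.exp (-(x + y) * t / (1 - t)) *
        ∑' k : ℕ, (α.factorial : ℝ) / (k.factorial * (k + α).factorial) *
          (x * y * t / (1 - t) ^ 2) ^ k) := by
  have h := (summable_laguerreTerm α x y ht).hasSum
  rwa [(h.prod_fiberwise (hasSum_laguerreTerm_right α x y ht)).unique
    (hasSum_sum_hilleTerm α x y (abs_lt.1 ht).2.ne)] at h

theorem prod_Icc_add_eq_factorial_div (α : ℕ) {k n : ℕ} (h : k ≤ n) :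
    ∏ j ∈ Icc (k + 1) n, ((α : ℝ) + j) = (α + n).factorial / (α + k).factorial := by
  induction n, h using Nat.le_induction with
  | base => simp [Nat.factorial_ne_zero]
  | succ n hn ih =>
    rw [prod_Icc_succ_top (by omega), ih, ← add_assoc, Nat.factorial_succ]
    push_cast
    ring

theorem genLaguerre_eq_sum_choose (n α : ℕ) (x : ℝ) :
    genLaguerre n α x =
      ∑ k ∈ range (n + 1), ((n + α).choose (α + k) : ℝ) * (-x) ^ k / k.factorial := by
  refine sum_congr rfl fun k hk => ?_
  have hk' : k ≤ n := Nat.lt_succ_iff.1 (mem_range.1 hk)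
  obtain ⟨d, rfl⟩ := Nat.exists_eq_add_of_le hk'
  rw [prod_Icc_add_eq_factorial_div α hk', show k + d - k = d by omega,
    show k + d + α = α + k + d by ring, Nat.cast_add_choose, neg_pow x, ← add_assoc]
  ring

theorem hasSum_laguerreTerm_left (α : ℕ) (x y t : ℝ) (n : ℕ) :
    HasSum (fun p : ℕ × ℕ => laguerreTerm α x y t p n)
      ((n.factorial : ℝ) * α.factorial / (n + α).factorial *
        genLaguerre n α x * genLaguerre n α y * t ^ n) := by
  have h0 : ∀ p ∉ range (n + 1) ×ˢ range (n + 1), laguerreTerm α x y t p n = 0 := by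
    intro p hp
    simp only [mem_product, mem_range, not_and_or, not_lt] at hp
    rcases hp with h | h
    · simp [laguerreTerm, Nat.choose_eq_zero_of_lt (show n < p.1 by omega)]
    · simp [laguerreTerm, Nat.choose_eq_zero_of_lt (show n + α < α + p.2 by omega)]
  convert hasSum_sum_of_ne_finset_zero (L := .unconditional _) h0 using 1
  rw [genLaguerre_eq_sum_choose, genLaguerre_eq_sum_choose, mul_assoc (_ / _), sum_mul_sum,
    ← sum_product', mul_sum, sum_mul]
  refine sum_congr rfl fun p hp => ?_
  have hp' : p.1 ≤ n := Nat.lt_succ_iff.1 (mem_range.1 (mem_product.1 hp).1)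
  obtain ⟨j, k⟩ := p
  obtain ⟨d, rfl⟩ := Nat.exists_eq_add_of_le hp'
  have h1 := Nat.cast_ne_zero (R := ℝ).2 (α + j + d).factorial_ne_zero
  simp only [laguerreTerm]
  rw [show j + d + α = α + j + d by ring, Nat.cast_add_choose, Nat.cast_add_choose]
  field_simp

/-- Hardy–Hille formula: for `α ∈ ℕ`, `x, y ≥ 0` and `|t| < 1`,
`∑_n (n!·α!/(n+α)!)·L_n^{(α)}(x)·L_n^{(α)}(y)·t^n
  = (1−t)^{−(α+1)}·exp(−(x+y)t/(1−t))·∑_k (α!/(k!(k+α)!))·(xyt/(1−t)²)^k`,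
both series being absolutely convergent. -/
theorem hardy_hille (α : ℕ) (x y : ℝ) (hx : 0 ≤ x) (hy : 0 ≤ y)
    (t : ℝ) (ht : |t| < 1) :
    Summable (fun n : ℕ =>
      |(n.factorial : ℝ) * α.factorial / (n + α).factorial *
        genLaguerre n α x * genLaguerre n α y * t ^ n|) ∧
    Summable (fun k : ℕ =>
      |(α.factorial : ℝ) / (k.factorial * (k + α).factorial) *
        (x * y * t / (1 - t) ^ 2) ^ k|) ∧
    (∑' n : ℕ, (n.factorial : ℝ) * α.factorial / (n + α).factorial *
        genLaguerre n α x * genLaguerre n α y * t ^ n)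
      = (1 - t) ^ (-(α + 1 : ℤ)) * Real.exp (-(x + y) * t / (1 - t)) *
        ∑' k : ℕ, (α.factorial : ℝ) / (k.factorial * (k + α).factorial) *
          (x * y * t / (1 - t) ^ 2) ^ k := by
  have hF := hasSum_laguerreTerm α x y ht
  have hL := ((Equiv.prodComm _ _).hasSum_iff.2 hF).prod_fiberwise
    (hasSum_laguerreTerm_left α x y t)
  exact ⟨hL.summable.abs, summable_hypergeometric_zero_one α _, hL.tsum_eq⟩
end
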